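/- Let d ≥ 1, τ > 0, T > 0, let p ≥ 1 be a real number, and let g : [0,T] → ℝ^d be continuous. Then for every t ∈ [0,T], ‖∫₀^t e^{(s−t)/τ} g(s) ds‖^{2p} ≤ τ^{2p−1} ∫₀^t ‖g(s)‖^{2p} ds. -/

import Mathlib

open Real MeasureTheory intervalIntegral Set

lemma memLp_aux {f : ℝ → ℝ} {t : ℝ} (hf : ContinuousOn f (Set.Icc 0 t)) (q : ENNReal) :
    MemLp f q (volume.restrict (Set.Ioc 0 t)) := by
  obtain ⟨C, hC⟩ := isCompact_Icc.exists_bound_of_continuousOn hf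
  refine MemLp.of_bound ((hf.mono Ioc_subset_Icc_self).aestronglyMeasurable measurableSet_Ioc) C ?_
  refine (ae_restrict_iff' measurableSet_Ioc).2 (Filter.Eventually.of_forall fun x hx => ?_)
  exact hC x (Ioc_subset_Icc_self hx)

lemma exp_int_aux {τ t r : ℝ} (hτ : 0 < τ) (ht : 0 ≤ t) (hr : 1 ≤ r) :
    ∫ s in (0:ℝ)..t, (Real.exp ((s - t) / τ)) ^ r ≤ τ := by
  have h1 : ∫ s in (0:ℝ)..t, Real.exp ((s - t) / τ) = τ - τ * Real.exp ((0 - t) / τ) := by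
    have := integral_eq_sub_of_hasDerivAt (a := 0) (b := t)
      (f := fun s => τ * Real.exp ((s - t) / τ)) (f' := fun s => Real.exp ((s - t) / τ))
      (fun x _ => by
        have h := ((((hasDerivAt_id x).sub_const t).div_const τ).exp).const_mul τ
        have e : τ * (Real.exp ((id x - t) / τ) * (1 / τ)) = Real.exp ((x - t) / τ) := by
          rw [id, mul_comm, mul_assoc, one_div, inv_mul_cancel₀ hτ.ne', mul_one]
        exact e ▸ h)
      (Continuous.intervalIntegrable (by fun_prop) _ _)
    rw [this]; simp
  have h2 : ∫ s in (0:ℝ)..t, (Real.exp ((s - t) / τ)) ^ r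
      ≤ ∫ s in (0:ℝ)..t, Real.exp ((s - t) / τ) := by
    apply integral_mono_on ht
    · simp_rw [← Real.exp_mul]
      exact Continuous.intervalIntegrable (by fun_prop) _ _
    · exact Continuous.intervalIntegrable (by fun_prop) _ _
    · intro x hx
      rw [← Real.exp_mul]
      apply Real.exp_le_exp.2
      have : (x - t) / τ ≤ 0 := div_nonpos_of_nonpos_of_nonneg (by linarith [hx.2]) hτ.le
      nlinarith
  have := mul_pos hτ (Real.exp_pos ((0 - t) / τ))
  linarith

/-- Hölder-inequality estimate (the deterministic core of Lemma 3.4): for a real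
exponent `p ≥ 1` and continuous `g : [0,T] → ℝ^d`,
`‖∫₀^t e^{(s−t)/τ} g(s) ds‖^{2p} ≤ τ^{2p−1} ∫₀^t ‖g(s)‖^{2p} ds`. -/
theorem exp_weighted_integral_holder_bound
    (d : ℕ) (hd : 1 ≤ d) (τ T : ℝ) (hτ : 0 < τ) (hT : 0 < T)
    (p : ℝ) (hp : 1 ≤ p)
    (g : ℝ → EuclideanSpace ℝ (Fin d)) (hg : ContinuousOn g (Set.Icc 0 T)) :
    ∀ t ∈ Set.Icc (0:ℝ) T,
      ‖∫ s in (0:ℝ)..t, Real.exp ((s - t) / τ) • g s‖ ^ (2 * p)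
        ≤ τ ^ (2 * p - 1) * ∫ s in (0:ℝ)..t, ‖g s‖ ^ (2 * p) := by
  rintro t ⟨ht0, htT⟩
  have hg' : ContinuousOn (fun s => ‖g s‖) (Set.Icc 0 t) :=
    (hg.mono (Icc_subset_Icc_right htT)).norm
  have hq : (2 * p).HolderConjugate (Real.conjExponent (2 * p)) :=
    Real.HolderConjugate.conjExponent (by linarith)
  set r := Real.conjExponent (2 * p) with hr
  have hr1 : 1 < r := hq.symm.lt
  have hG : 0 ≤ ∫ s in (0:ℝ)..t, ‖g s‖ ^ (2 * p) :=
    integral_nonneg ht0 fun s _ => by positivity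
  have hE : 0 ≤ ∫ s in (0:ℝ)..t, (Real.exp ((s - t) / τ)) ^ r :=
    integral_nonneg ht0 fun s _ => by positivity
  have hH : ∫ s in (0:ℝ)..t, Real.exp ((s - t) / τ) * ‖g s‖ ≤
      (∫ s in (0:ℝ)..t, (Real.exp ((s - t) / τ)) ^ r) ^ (1 / r) *
      (∫ s in (0:ℝ)..t, ‖g s‖ ^ (2 * p)) ^ (1 / (2 * p)) := by
    simp only [integral_of_le ht0]
    exact integral_mul_le_Lp_mul_Lq_of_nonneg hq.symm
      (Filter.Eventually.of_forall fun s => (Real.exp_pos _).le)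
      (Filter.Eventually.of_forall fun s => norm_nonneg _)
      (memLp_aux (by fun_prop) _) (memLp_aux hg' _)
  have hN : ‖∫ s in (0:ℝ)..t, Real.exp ((s - t) / τ) • g s‖ ≤
      τ ^ (1 / r) * (∫ s in (0:ℝ)..t, ‖g s‖ ^ (2 * p)) ^ (1 / (2 * p)) := by
    calc _ ≤ ∫ s in (0:ℝ)..t, ‖Real.exp ((s - t) / τ) • g s‖ :=
          norm_integral_le_integral_norm ht0
      _ = ∫ s in (0:ℝ)..t, Real.exp ((s - t) / τ) * ‖g s‖ := by
          simp [norm_smul]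
      _ ≤ _ := hH
      _ ≤ _ := by
          gcongr
          exact exp_int_aux hτ ht0 hr1.le
  have hp0 : 0 < 2 * p := by linarith
  calc _ ≤ (τ ^ (1 / r) * (∫ s in (0:ℝ)..t, ‖g s‖ ^ (2 * p)) ^ (1 / (2 * p))) ^ (2 * p) := by
        gcongr
    _ = _ := by
        rw [Real.mul_rpow (by positivity) (by positivity), ← Real.rpow_mul hτ.le,
          ← Real.rpow_mul hG]
        have e1 : 1 / (2 * p) * (2 * p) = 1 := by field_simp
        have e2 : 1 / r * (2 * p) = 2 * p - 1 := by
          have := hq.inv_add_inv_eq_one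
          have h3 : 1 / r = 1 - (2 * p)⁻¹ := by rw [one_div]; linarith
          rw [h3, sub_mul, inv_mul_cancel₀ hp0.ne', one_mul]
        rw [e1, e2, Real.rpow_one]
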